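/- Let (a,b) ∈ P with |a| > 2. Then N(a,b) ≥ 2 + √((|a| − 2)/(2(1 + b − |a|))). Equivalently: whenever s, t ∈ ℝ[x] are polynomials nonnegative on ℝ with 1 = t(x)·(x² + ax + b) − s(x)·(x² − 1), one has (deg t)² ≥ 2(|a| − 2)/(1 + b − |a|). -/

import Mathlib

open Polynomial

noncomputable section

/-- The defining polynomial `y² + q(x)` of the curve, as a polynomial in `y`
over `ℝ[x]`. -/
def curvePoly (q : Polynomial ℝ) : Polynomial (Polynomial ℝ) :=
  X ^ 2 + C q

lemma curvePoly_monic (q : Polynomial ℝ) : (curvePoly q).Monic :=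
  Polynomial.monic_X_pow_add_C q (by norm_num)

/-- The coordinate ring `ℝ[C] = ℝ[x,y]/(y² + q(x))`. -/
abbrev CurveRing (q : Polynomial ℝ) : Type := AdjoinRoot (curvePoly q)

/-- The unique representative `a(x) + b(x)·y` (of `y`-degree `< 2`) of an element. -/
def curveRep (q : Polynomial ℝ) (f : CurveRing q) : Polynomial (Polynomial ℝ) :=
  AdjoinRoot.modByMonicHom (curvePoly_monic q) f

/-- The polynomial `a(x)` with `f = a(x) + b(x)·y`. -/
def repA (q : Polynomial ℝ) (f : CurveRing q) : Polynomial ℝ := (curveRep q f).coeff 0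

/-- The polynomial `b(x)` with `f = a(x) + b(x)·y`. -/
def repB (q : Polynomial ℝ) (f : CurveRing q) : Polynomial ℝ := (curveRep q f).coeff 1

/-- `δ(f) = max (deg a, 2 + deg b)` for `f = a(x) + b(x)·y ≠ 0`. -/
def curveDelta (q : Polynomial ℝ) (f : CurveRing q) : ℕ :=
  if repB q f = 0 then (repA q f).natDegree
  else max (repA q f).natDegree (2 + (repB q f).natDegree)

/-- `f ∈ ℝ[C]` is psd: nonnegative at all real points of the curve. -/
def IsPsd (q : Polynomial ℝ) (f : CurveRing q) : Prop :=
  ∀ u v : ℝ, v ^ 2 + q.eval u = 0 → 0 ≤ (repA q f).eval u + (repB q f).eval u * v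

/-- `f` is a sum of squares of elements of `δ`-degree at most `d`. -/
def IsSosLe (q : Polynomial ℝ) (f : CurveRing q) (d : ℕ) : Prop :=
  ∃ (r : ℕ) (g : Fin r → CurveRing q), f = ∑ i, g i ^ 2 ∧ ∀ i, curveDelta q (g i) ≤ d

/-- `θ(f)`: the least `d` such that `f` is a sum of squares of elements of
`δ`-degree `≤ d`, and `∞` if `f` is not a sum of squares. -/
def curveTheta (q : Polynomial ℝ) (f : CurveRing q) : ℕ∞ :=
  sInf {d : ℕ∞ | ∃ n : ℕ, d = (n : ℕ∞) ∧ IsSosLe q f n}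

/-- All zeros of `f` on `C(ℂ)` are real. -/
def AllZerosReal (q : Polynomial ℝ) (f : CurveRing q) : Prop :=
  ∀ u v : ℂ, v ^ 2 + (q.map (algebraMap ℝ ℂ)).eval u = 0 →
    ((repA q f).map (algebraMap ℝ ℂ)).eval u +
      ((repB q f).map (algebraMap ℝ ℂ)).eval u * v = 0 →
    u.im = 0 ∧ v.im = 0

/-- The parameter set `P`. -/
def Pset : Set (ℝ × ℝ) :=
  {p | p.1 ^ 2 - 4 * p.2 < 0 ∨ (0 < p.1 ^ 2 - 4 * p.2 ∧ |p.1| < min 2 (p.2 + 1))}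

/-- The boundary set `P'` of the closure of `P`. -/
def Pbdry : Set (ℝ × ℝ) :=
  {p | (p.1 ^ 2 = 4 * p.2 ∧ 4 ≤ p.1 ^ 2) ∨ (|p.1| = p.2 + 1 ∧ |p.1| ≤ 2)}

/-- The quartic `q_{a,b}(x) = (x² − 1)(x² + ax + b)`. -/
def qab (a b : ℝ) : Polynomial ℝ := (X ^ 2 - 1) * (X ^ 2 + C a * X + C b)

/-- The stability constant `N(a,b) = θ(1 − x²)`, computed in `ℝ[C_{a,b}]`. -/
def Nab (a b : ℝ) : ℕ∞ :=
  curveTheta (qab a b) (AdjoinRoot.of (curvePoly (qab a b)) (1 - X ^ 2))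

/-- V. A. Markov's bound for the first derivative at the endpoint `1` of `[-1, 1]`. -/
lemma eval_one_derivative_le_sq_natDegree {P : Polynomial ℝ}
    (hP : ∀ x ∈ Set.Icc (-1 : ℝ) 1, |P.eval x| ≤ 1) :
    (derivative P).eval 1 ≤ (P.natDegree : ℝ) ^ 2 := by
  have h := Polynomial.Chebyshev.eval_iterate_derivative_le_of_forall_abs_le_one
    (k := 1) (x := 1) le_rfl (degree_le_natDegree (p := P)) hP
  simpa [Polynomial.Chebyshev.derivative_T_eval_one] using h

lemma one_add_sub_abs_pos {a b : ℝ} (h : a ^ 2 < 4 * b) : 0 < 1 + b - |a| := by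
  nlinarith [sq_nonneg (|a| - 2), sq_abs a]

/-- The degree bound for certificates when the minimum of `x² + ax + b` on `[-1, 1]` is
attained at `1`. -/
lemma sq_natDegree_ge_of_certificate_of_lt_neg_two {a b : ℝ} (hab : a ^ 2 < 4 * b) (ha : a < -2)
    {s t : Polynomial ℝ} (hs : ∀ x : ℝ, 0 ≤ s.eval x) (ht : ∀ x : ℝ, 0 ≤ t.eval x)
    (h : (1 : Polynomial ℝ) = t * (X ^ 2 + C a * X + C b) - s * (X ^ 2 - 1)) :
    2 * (-a - 2) / (1 + b + a) ≤ (t.natDegree : ℝ) ^ 2 := by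
  have hm : 0 < 1 + b + a := by
    simpa [abs_of_neg (show a < 0 by linarith)] using one_add_sub_abs_pos hab
  have heval (x : ℝ) : 1 = t.eval x * (x ^ 2 + a * x + b) - s.eval x * (x ^ 2 - 1) := by
    simpa using congrArg (eval x) h
  have hderiv : (0 : ℝ) = (derivative t).eval 1 * (1 + a + b) + t.eval 1 * (2 + a)
      - s.eval 1 * 2 := by
    have := congrArg (fun f => (derivative f).eval 1) h
    simpa [one_add_one_eq_two] using this
  have hle (x : ℝ) (hx : x ∈ Set.Icc (-1 : ℝ) 1) : (1 + b + a) * t.eval x ≤ 1 := by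
    obtain ⟨h₁, h₂⟩ := hx
    have h₃ : 0 ≤ (1 - x) * (-x - 1 - a) := mul_nonneg (by linarith) (by linarith)
    have h₄ : 0 ≤ (1 - x) * (1 + x) := mul_nonneg (by linarith) (by linarith)
    nlinarith [heval x, mul_nonneg (ht x) h₃, mul_nonneg (hs x) h₄]
  set P : Polynomial ℝ := C (2 * (1 + b + a)) * t - 1 with hPdef
  have hP : (derivative P).eval 1 ≤ (P.natDegree : ℝ) ^ 2 := by
    refine eval_one_derivative_le_sq_natDegree fun x hx => ?_
    have h₀ := mul_nonneg hm.le (ht x)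
    have h₁ := hle x hx
    rw [abs_le]
    simp only [hPdef, eval_sub, eval_mul, eval_C, eval_one]
    constructor <;> linarith
  have hdeg : P.natDegree = t.natDegree := by
    rw [hPdef, ← C_1, natDegree_sub_C, natDegree_C_mul (by positivity)]
  have hP' : (derivative P).eval 1 = 2 * (1 + b + a) * (derivative t).eval 1 := by
    simp [hPdef]
  rw [hdeg, hP'] at hP
  refine le_trans ?_ hP
  rw [div_le_iff₀ hm]
  have h₁ : t.eval 1 * (1 + b + a) = 1 := by linarith [heval 1]
  have h₂ : (derivative t).eval 1 * (1 + b + a) ≥ - t.eval 1 * (2 + a) := by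
    linarith [hs 1]
  nlinarith [mul_le_mul_of_nonneg_left h₂ hm.le]

/-- Every certificate `1 = t·(x² + ax + b) − s·(x² − 1)` with `s`, `t` nonnegative on `ℝ` has
large degree when `x² + ax + b` is positive on `ℝ` and `|a| > 2`. -/
lemma sq_natDegree_ge_of_certificate {a b : ℝ} (hab : a ^ 2 < 4 * b) (ha : 2 < |a|)
    {s t : Polynomial ℝ} (hs : ∀ x : ℝ, 0 ≤ s.eval x) (ht : ∀ x : ℝ, 0 ≤ t.eval x)
    (h : (1 : Polynomial ℝ) = t * (X ^ 2 + C a * X + C b) - s * (X ^ 2 - 1)) :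
    2 * (|a| - 2) / (1 + b - |a|) ≤ (t.natDegree : ℝ) ^ 2 := by
  rcases le_total a 0 with ha₀ | ha₀
  · rw [abs_of_nonpos ha₀] at ha ⊢
    simpa using sq_natDegree_ge_of_certificate_of_lt_neg_two hab (by linarith) hs ht h
  · rw [abs_of_nonneg ha₀] at ha ⊢
    have h' : (1 : Polynomial ℝ) = t.comp (-X) * (X ^ 2 + C (-a) * X + C b)
        - s.comp (-X) * (X ^ 2 - 1) := by
      simpa using congrArg (fun f => f.comp (-X)) h
    have := sq_natDegree_ge_of_certificate_of_lt_neg_two (a := -a) (by simpa using hab)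
      (by linarith) (fun x => by simpa using hs (-x)) (fun x => by simpa using ht (-x)) h'
    simpa [natDegree_comp, sub_eq_add_neg] using this

lemma curveRep_mk (q A B : Polynomial ℝ) :
    curveRep q (AdjoinRoot.mk (curvePoly q) (C A + C B * X)) = C A + C B * X := by
  rw [curveRep, AdjoinRoot.modByMonicHom_mk, modByMonic_eq_self_iff (curvePoly_monic q), add_comm]
  refine degree_linear_le.trans_lt ?_
  rw [curvePoly, degree_X_pow_add_C (by norm_num)]
  norm_num

lemma natDegree_curveRep_le (q : Polynomial ℝ) (f : CurveRing q) :
    (curveRep q f).natDegree ≤ 1 := by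
  induction f using AdjoinRoot.induction_on with
  | ih p =>
    rw [curveRep, AdjoinRoot.modByMonicHom_mk]
    have h := natDegree_modByMonic_lt p (curvePoly_monic q) fun h => by
      simpa [curvePoly, natDegree_X_pow_add_C] using congrArg natDegree h
    rw [curvePoly, natDegree_X_pow_add_C] at h
    rw [curvePoly]
    omega

lemma mk_repA_add_repB (q : Polynomial ℝ) (f : CurveRing q) :
    AdjoinRoot.mk (curvePoly q) (C (repA q f) + C (repB q f) * X) = f := by
  conv_rhs => rw [← AdjoinRoot.mk_leftInverse (curvePoly_monic q) f]
  congr 1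
  rw [add_comm]
  exact (eq_X_add_C_of_natDegree_le_one (natDegree_curveRep_le q f)).symm

lemma repA_of (q A : Polynomial ℝ) : repA q (AdjoinRoot.of (curvePoly q) A) = A := by
  have := curveRep_mk q A 0
  simp only [C_0, zero_mul, add_zero, AdjoinRoot.mk_C] at this
  simp [repA, this]

lemma repA_sq (q : Polynomial ℝ) (f : CurveRing q) :
    repA q (f ^ 2) = repA q f ^ 2 - repB q f ^ 2 * q := by
  have h : f ^ 2 = AdjoinRoot.mk (curvePoly q)
      (C (repA q f ^ 2 - repB q f ^ 2 * q) + C (2 * repA q f * repB q f) * X) := by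
    conv_lhs => rw [← mk_repA_add_repB q f, ← map_pow]
    rw [AdjoinRoot.mk_eq_mk]
    refine ⟨C (repB q f ^ 2), ?_⟩
    simp only [curvePoly, map_sub, map_mul, map_pow, map_ofNat]
    ring
  rw [repA, h, curveRep_mk, coeff_add, coeff_C_zero, mul_coeff_zero, coeff_X_zero, mul_zero,
    add_zero]

lemma repA_sum (q : Polynomial ℝ) {ι : Type*} (S : Finset ι) (g : ι → CurveRing q) :
    repA q (∑ i ∈ S, g i) = ∑ i ∈ S, repA q (g i) := by
  simp [repA, curveRep, finsetSum_coeff]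

lemma repA_sum_sq (q : Polynomial ℝ) {ι : Type*} (S : Finset ι) (g : ι → CurveRing q) :
    repA q (∑ i ∈ S, g i ^ 2) = ∑ i ∈ S, repA q (g i) ^ 2 - (∑ i ∈ S, repB q (g i) ^ 2) * q := by
  rw [repA_sum, Finset.sum_congr rfl fun i _ => repA_sq q (g i), Finset.sum_sub_distrib,
    Finset.sum_mul]

/-- A sum of squares representation of `1 − x²` of `δ`-degree `n` gives a certificate
`1 = t·(x² + ax + b) − s·(x² − 1)` with `deg t ≤ 2(n − 2)`. -/
lemma exists_certificate_of_isSosLe {a b : ℝ} {n : ℕ}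
    (h : IsSosLe (qab a b) (AdjoinRoot.of (curvePoly (qab a b)) (1 - X ^ 2)) n) :
    ∃ s t : Polynomial ℝ, (∀ x : ℝ, 0 ≤ s.eval x) ∧ (∀ x : ℝ, 0 ≤ t.eval x) ∧
      (1 : Polynomial ℝ) = t * (X ^ 2 + C a * X + C b) - s * (X ^ 2 - 1) ∧
      (t ≠ 0 → 2 ≤ n) ∧ t.natDegree ≤ 2 * (n - 2) := by
  generalize hq : qab a b = q at h
  obtain ⟨r, g, hg, hd⟩ := h
  have hsum : (1 - X ^ 2 : Polynomial ℝ)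
      = ∑ i, repA q (g i) ^ 2 - (∑ i, repB q (g i) ^ 2) * q := by
    rw [← repA_sum_sq, ← hg, repA_of]
  have hzero (x : ℝ) (hx : x ^ 2 = 1) (i : Fin r) : (repA q (g i)).IsRoot x := by
    have h₁ := congrArg (eval x) hsum
    simp only [← hq, qab, eval_sub, eval_one, eval_pow, eval_X, hx, eval_mul, sub_self, zero_mul,
      mul_zero, sub_zero, eval_finsetSum] at h₁
    have := (Finset.sum_eq_zero_iff_of_nonneg fun j _ => sq_nonneg _).mp h₁.symm i
      (Finset.mem_univ i)
    simpa [IsRoot] using this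
  have hdvd (i : Fin r) : (X ^ 2 - 1 : Polynomial ℝ) ∣ repA q (g i) := by
    have h₁ := dvd_iff_isRoot.mpr (hzero 1 (by norm_num) i)
    have h₂ := dvd_iff_isRoot.mpr (hzero (-1) (by norm_num) i)
    have hc : IsCoprime (X - C (1 : ℝ)) (X - C (-1)) :=
      isCoprime_X_sub_C_of_isUnit_sub (by norm_num)
    convert hc.mul_dvd h₁ h₂ using 1
    simp only [map_one, map_neg]
    ring
  choose c hc using hdvd
  have hne : (X ^ 2 - 1 : Polynomial ℝ) ≠ 0 := (monic_X_pow_sub_C 1 two_ne_zero).ne_zero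
  have hB (i : Fin r) (hi : repB q (g i) ≠ 0) : 2 + (repB q (g i)).natDegree ≤ n := by
    have := hd i
    rw [curveDelta, if_neg hi] at this
    exact (le_max_right _ _).trans this
  refine ⟨∑ i, c i ^ 2, ∑ i, repB q (g i) ^ 2, fun x => ?_, fun x => ?_, ?_, fun ht => ?_, ?_⟩
  · simpa [eval_finsetSum] using Finset.sum_nonneg fun i _ => sq_nonneg ((c i).eval x)
  · simpa [eval_finsetSum] using Finset.sum_nonneg fun i _ => sq_nonneg ((repB q (g i)).eval x)
  · apply mul_left_cancel₀ hne
    have hA : ∑ i, repA q (g i) ^ 2 = (X ^ 2 - 1) ^ 2 * ∑ i, c i ^ 2 := by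
      rw [Finset.mul_sum]
      exact Finset.sum_congr rfl fun i _ => by rw [hc i, mul_pow]
    rw [hA] at hsum
    rw [qab] at hq
    linear_combination -hsum - (∑ i, repB q (g i) ^ 2) * hq
  · obtain ⟨i, -, hi⟩ := Finset.exists_ne_zero_of_sum_ne_zero ht
    have := hB i (by simpa using hi)
    omega
  · refine natDegree_sum_le_of_forall_le _ _ fun i _ => ?_
    rw [natDegree_pow]
    by_cases hi : repB q (g i) = 0
    · simp [hi]
    · have := hB i hi
      omega

lemma IsSosLe.mono {q : Polynomial ℝ} {f : CurveRing q} {m n : ℕ} (h : IsSosLe q f m)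
    (hmn : m ≤ n) : IsSosLe q f n := by
  obtain ⟨r, g, hg, hd⟩ := h
  exact ⟨r, g, hg, fun i => (hd i).trans hmn⟩

lemma isSosLe_of_curveTheta_le {q : Polynomial ℝ} {f : CurveRing q} {n : ℕ}
    (h : curveTheta q f ≤ n) : IsSosLe q f n := by
  have hne : {d : ℕ∞ | ∃ n : ℕ, d = (n : ℕ∞) ∧ IsSosLe q f n}.Nonempty := by
    rw [Set.nonempty_iff_ne_empty]
    intro he
    rw [curveTheta, he, sInf_empty] at h
    exact ENat.natCast_ne_top n (top_le_iff.mp h)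
  obtain ⟨m, hm, hs⟩ := csInf_mem hne
  rw [curveTheta, hm] at h
  exact hs.mono (by exact_mod_cast h)

/-- Proposition 4.8 / `markovbd`: for `(a,b) ∈ P` with `|a| > 2`,
`N(a,b) ≥ 2 + √((|a|−2)/(2(1+b−|a|)))`; equivalently, any certificate
`1 = t·(x²+ax+b) − s·(x²−1)` with `s, t` nonnegative on `ℝ` satisfies
`(deg t)² ≥ 2(|a|−2)/(1+b−|a|)`. -/
theorem markov_lower_bound_for_stability_constant
    (a b : ℝ) (hab : (a, b) ∈ Pset) (ha : 2 < |a|) :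
    (∀ n : ℕ, Nab a b ≤ (n : ℕ∞) →
      2 + Real.sqrt ((|a| - 2) / (2 * (1 + b - |a|))) ≤ (n : ℝ)) ∧
    (∀ s t : Polynomial ℝ, (∀ x : ℝ, 0 ≤ s.eval x) → (∀ x : ℝ, 0 ≤ t.eval x) →
      (1 : Polynomial ℝ) = t * (X ^ 2 + C a * X + C b) - s * (X ^ 2 - 1) →
      2 * (|a| - 2) / (1 + b - |a|) ≤ (t.natDegree : ℝ) ^ 2) := by
  have hdisc : a ^ 2 < 4 * b := by
    rcases hab with h | ⟨-, h⟩
    · simpa using h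
    · exact absurd (h.trans_le (min_le_left _ _)) ha.not_gt
  have hm := one_add_sub_abs_pos hdisc
  refine ⟨fun n hn => ?_, fun s t hs ht h => sq_natDegree_ge_of_certificate hdisc ha hs ht h⟩
  obtain ⟨s, t, hs, ht, h, hn₂, hdeg⟩ :=
    exists_certificate_of_isSosLe (isSosLe_of_curveTheta_le hn)
  have hle := sq_natDegree_ge_of_certificate hdisc ha hs ht h
  have hpos : 0 < 2 * (|a| - 2) / (1 + b - |a|) := div_pos (by linarith) hm
  have hn₂ : 2 ≤ n := hn₂ fun ht₀ => by
    rw [ht₀, natDegree_zero] at hle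
    norm_num at hle
    linarith
  have hdeg' : (t.natDegree : ℝ) ≤ 2 * (n - 2) := by
    have : (t.natDegree : ℝ) ≤ ((2 * (n - 2) : ℕ) : ℝ) := by exact_mod_cast hdeg
    simpa [Nat.cast_sub hn₂] using this
  have hn₀ : (0 : ℝ) ≤ n - 2 := by
    rw [sub_nonneg]
    exact_mod_cast hn₂
  have hsqrt : Real.sqrt ((|a| - 2) / (2 * (1 + b - |a|))) ≤ n - 2 := by
    rw [Real.sqrt_le_left hn₀]
    have h₁ : (t.natDegree : ℝ) ^ 2 ≤ (2 * (n - 2)) ^ 2 := by gcongr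
    have h₂ : (|a| - 2) / (2 * (1 + b - |a|)) = 2 * (|a| - 2) / (1 + b - |a|) / 4 := by
      field_simp
      ring
    rw [h₂]
    linarith
  linarith

end
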